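/- Let 𝔣 be continuous of bounded variation with ∫_𝕋 𝔣(x) dx = 0, and let 𝔭(x) = e^{𝔣(x)}/(1+e^{𝔣(x)}). Fix an integer a ≠ 0, let τ_1 < τ_2 < ⋯ be the moments of consecutive visits of (ξ_n) to a, and let A_k be the event that τ_k occurs before the first return of (ξ_n) to 0. Then for every k and every ε > 0 there exists m such that ℙ_x(τ_k > m | A_k) < ε for every x ∈ 𝕋. -/

import Mathlib

open MeasureTheory Filter Finset

noncomputable section

attribute [local instance] Classical.propDecidable

/-- The point `x + j·α` on the circle `𝕋 = ℝ/ℤ`. -/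
def pt (α : ℝ) (x : UnitAddCircle) (j : ℤ) : UnitAddCircle :=
  x + (((j : ℝ) * α : ℝ) : UnitAddCircle)

/-- One-step transition probability of the random walk on `ℤ` in the quasi-periodic
environment `(𝔭, α, x)`: from `j` it jumps to `j+1` with probability `𝔭(x+jα)` and to
`j-1` with probability `𝔮(x+jα) = 1-𝔭(x+jα)`. -/
def stepProb (𝔭 : UnitAddCircle → ℝ) (α : ℝ) (x : UnitAddCircle) (j j' : ℤ) : ℝ :=
  if j' = j + 1 then 𝔭 (pt α x j) else if j' = j - 1 then 1 - 𝔭 (pt α x j) else 0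

/-- `ξ` is (a version of) the random walk on `ℤ` in the quasi-periodic environment
`(𝔭, α, x)` started at `start`, defined on the probability space `(Ω, ℙ)`; this is
expressed through its finite-dimensional distributions. -/
def IsQPWalk (𝔭 : UnitAddCircle → ℝ) (α : ℝ) (x : UnitAddCircle) (start : ℤ)
    {Ω : Type} [MeasurableSpace Ω] (ℙ : Measure Ω) (ξ : ℕ → Ω → ℤ) : Prop :=
  IsProbabilityMeasure ℙ ∧ (∀ n, Measurable (ξ n)) ∧
  ∀ (n : ℕ) (k : ℕ → ℤ),
    ℙ {ω | ∀ i ≤ n, ξ i ω = k i} =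
      ENNReal.ofReal ((if k 0 = start then (1 : ℝ) else 0) *
        ∏ i ∈ Finset.range n, stepProb 𝔭 α x (k i) (k (i + 1)))

/-- `𝔣` is continuous, of bounded variation, with `∫_𝕋 𝔣(z) dz = 0`. -/
def ZeroMeanBV (𝔣 : UnitAddCircle → ℝ) : Prop :=
  Continuous 𝔣 ∧ BoundedVariationOn (fun t : ℝ => 𝔣 (t : UnitAddCircle)) (Set.Icc 0 1) ∧
    ∫ z : UnitAddCircle, 𝔣 z = 0

/-- The function `𝔭 = e^𝔣/(1+e^𝔣)` associated to `𝔣`. -/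
def pOf (𝔣 : UnitAddCircle → ℝ) : UnitAddCircle → ℝ :=
  fun z => Real.exp (𝔣 z) / (1 + Real.exp (𝔣 z))

/-- The event `A_k` that the `k`-th visit of `(ξ_n)` to `a` occurs before the first
return of `(ξ_n)` to `0`: there is a time `n` at which the walk is at `a`, has not yet
visited `0` (at times `1,…,n`), and has made exactly `k` visits to `a` so far. -/
def visitEvent {Ω : Type} (ξ : ℕ → Ω → ℤ) (a : ℤ) (k : ℕ) : Set Ω :=
  {ω | ∃ n : ℕ, (∀ i ∈ Finset.Icc 1 n, ξ i ω ≠ 0) ∧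
    ((Finset.Icc 1 n).filter fun i => ξ i ω = a).card = k ∧ ξ n ω = a}

/-- The event `A_k ∩ {τ_k > m}`: the `k`-th visit to `a` occurs before the first return
to `0`, and it occurs strictly after time `m`. -/
def visitEventLate {Ω : Type} (ξ : ℕ → Ω → ℤ) (a : ℤ) (k m : ℕ) : Set Ω :=
  {ω | ∃ n : ℕ, m < n ∧ (∀ i ∈ Finset.Icc 1 n, ξ i ω ≠ 0) ∧
    ((Finset.Icc 1 n).filter fun i => ξ i ω = a).card = k ∧ ξ n ω = a}


def wv (p : UnitAddCircle → ℝ) (α : ℝ) (x : UnitAddCircle) : ℕ → ℤ → ℝ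
  | 0, _ => 1
  | m + 1, j => p (pt α x j) * (if j + 1 ≠ 0 then wv p α x m (j + 1) else 0) +
      (1 - p (pt α x j)) * (if j - 1 ≠ 0 then wv p α x m (j - 1) else 0)

lemma wv_nonneg {p : UnitAddCircle → ℝ} (h0 : ∀ z, 0 ≤ p z) (h1 : ∀ z, p z ≤ 1) (α : ℝ)
    (x : UnitAddCircle) (m : ℕ) : ∀ j, 0 ≤ wv p α x m j := by
  induction m with
  | zero => intro j; simp [wv]
  | succ m ih =>
    intro j
    have a1 := h0 (pt α x j)
    have a2 : 0 ≤ 1 - p (pt α x j) := sub_nonneg.2 (h1 _)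
    rw [wv]
    refine add_nonneg (mul_nonneg a1 ?_) (mul_nonneg a2 ?_)
    · split_ifs
      · exact ih _
      · exact le_rfl
    · split_ifs
      · exact ih _
      · exact le_rfl

lemma wv_succ_le {p : UnitAddCircle → ℝ} (h0 : ∀ z, 0 ≤ p z) (h1 : ∀ z, p z ≤ 1) (α : ℝ)
    (x : UnitAddCircle) (m : ℕ) : ∀ j, wv p α x (m + 1) j ≤ wv p α x m j := by
  induction m with
  | zero =>
    intro j
    have a1 := h0 (pt α x j)
    have a2 := (h1 (pt α x j))
    simp only [wv]
    split_ifs <;> linarith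
  | succ m ih =>
    intro j
    have a1 := h0 (pt α x j)
    have a2 : 0 ≤ 1 - p (pt α x j) := sub_nonneg.2 (h1 _)
    rw [wv]
    conv_rhs => rw [wv]
    refine add_le_add (mul_le_mul_of_nonneg_left ?_ a1) (mul_le_mul_of_nonneg_left ?_ a2)
    · split_ifs
      · exact ih _
      · exact le_rfl
    · split_ifs
      · exact ih _
      · exact le_rfl

lemma wv_cont {p : UnitAddCircle → ℝ} (hp : Continuous p) (α : ℝ)
    (m : ℕ) : ∀ j, Continuous (fun x => wv p α x m j) := by
  induction m with
  | zero => intro j; simpa [wv] using continuous_const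
  | succ m ih =>
    intro j
    have hc : Continuous (fun x => p (pt α x j)) := hp.comp (by unfold pt; fun_prop)
    simp only [wv]
    refine (hc.mul ?_).add ((continuous_const.sub hc).mul ?_)
    · split_ifs
      · exact ih _
      · exact continuous_const
    · split_ifs
      · exact ih _
      · exact continuous_const

lemma wv_refl (p : UnitAddCircle → ℝ) (α : ℝ) (x : UnitAddCircle)
    (m : ℕ) : ∀ j, wv (fun z => 1 - p z) (-α) x m j = wv p α x m (-j) := by
  induction m with
  | zero => intro j; simp [wv]
  | succ m ih =>
    intro j
    have e : pt (-α) x j = pt α x (-j) := by simp [pt]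
    simp only [wv, ih, e]
    have e1 : -(j + 1) = -j - 1 := by ring
    have e2 : -(j - 1) = -j + 1 := by ring
    have c1 : (j + 1 ≠ 0) ↔ (-j - 1 ≠ 0) := by omega
    have c2 : (j - 1 ≠ 0) ↔ (-j + 1 ≠ 0) := by omega
    rw [e1, e2]
    simp only [c1, c2]
    ring

/-- purely analytic recurrence -/
lemma harm_zero (u : ℕ → ℝ) (f : ℕ → ℝ) (p : ℕ → ℝ) (hu0 : u 0 = 0) (hu : ∀ j, 0 ≤ u j)
    (hu1 : ∀ j, u j ≤ 1)
    (hp : ∀ j, 0 < p j) (hf : ∀ j, 1 - p j = Real.exp (- f j) * p j)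
    (hh : ∀ j, u (j + 1) = p j * u (j + 2) + (1 - p j) * u j)
    (C : ℝ) (hC : ∀ N : ℕ, ∃ q ≥ N, ∑ i ∈ range q, f i ≤ C) : u 1 = 0 := by
  have hd : ∀ j, u (j + 1) - u j = u 1 * Real.exp (- ∑ i ∈ range j, f i) := by
    intro j
    induction j with
    | zero => simp [hu0]
    | succ j ih =>
      rw [Finset.sum_range_succ, neg_add, Real.exp_add, ← mul_assoc, ← ih]
      have h := hh j
      have h2 := hf j
      have h3 := hp j
      have : p j * (u (j + 2) - u (j + 1)) = p j * ((u (j + 1) - u j) * Real.exp (- f j)) := by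
        have : p j * ((u (j + 1) - u j) * Real.exp (- f j)) = (u (j+1) - u j) * (1 - p j) := by
          rw [h2]; ring
        rw [this]; linarith
      exact mul_left_cancel₀ h3.ne' this
  have hmono : Monotone u := monotone_nat_of_le_succ fun j => by
    have := hd j
    have h2 : 0 ≤ u 1 * Real.exp (- ∑ i ∈ range j, f i) := mul_nonneg (hu 1) (Real.exp_pos _).le
    linarith
  have key : ∀ K : ℕ, ∃ j, K * (u 1 * Real.exp (-C)) ≤ u j := by
    intro K
    induction K with
    | zero => exact ⟨0, by simp [hu0]⟩
    | succ K ih =>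
      obtain ⟨j, hj⟩ := ih
      obtain ⟨q, hq, hqC⟩ := hC j
      refine ⟨q + 1, ?_⟩
      have h1 := hd q
      have h2 := hmono hq
      have h3 : u 1 * Real.exp (-C) ≤ u 1 * Real.exp (- ∑ i ∈ range q, f i) :=
        mul_le_mul_of_nonneg_left (Real.exp_le_exp.2 (by linarith)) (hu 1)
      push_cast
      linarith
  by_contra hne
  have hpos : 0 < u 1 * Real.exp (-C) :=
    mul_pos (lt_of_le_of_ne (hu 1) (Ne.symm hne)) (Real.exp_pos _)
  obtain ⟨K, hK⟩ := exists_nat_gt (1 / (u 1 * Real.exp (-C)))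
  obtain ⟨j, hj⟩ := key K
  rw [div_lt_iff₀ hpos] at hK
  linarith [hu1 j]

lemma den_unbounded {α : ℝ} (hα : Irrational α) (N : ℕ) :
    ∃ r : ℚ, N ≤ r.den ∧ |α - r| < 1 / (r.den : ℝ) ^ 2 := by
  by_contra hcon
  push Not at hcon
  apply Real.infinite_rat_abs_sub_lt_one_div_den_sq_of_irrational hα
  obtain ⟨M, hM⟩ := exists_nat_gt ((|α| + 1) * N)
  have hfin : (Set.Icc (-(M : ℤ)) M ×ˢ Set.Iic N).Finite :=
    (Set.finite_Icc _ _).prod (Set.finite_Iic _)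
  refine Set.Finite.of_finite_image (f := fun r : ℚ => (r.num, r.den)) (hfin.subset ?_) ?_
  · rintro _ ⟨r, hr, rfl⟩
    have hr' : |α - r| < 1 / (r.den : ℝ) ^ 2 := hr
    have hlt : r.den < N := by
      by_contra h
      exact absurd hr' (not_lt.2 (hcon r (not_lt.1 h)))
    have hd : (1 : ℝ) ≤ r.den := by exact_mod_cast r.den_pos
    have h1 : 1 / (r.den : ℝ) ^ 2 ≤ 1 := by
      rw [div_le_one (by positivity)]; nlinarith
    have h2 : |(r : ℝ)| ≤ |α| + 1 := by
      have := abs_sub_abs_le_abs_sub (r : ℝ) α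
      rw [abs_sub_comm] at this
      linarith
    have h3 : (r.num : ℝ) = r * r.den := by
      have := Rat.mul_den_eq_num r
      exact_mod_cast this.symm
    have h4 : |(r.num : ℝ)| ≤ M := by
      rw [h3, abs_mul, abs_of_nonneg (by positivity : (0 : ℝ) ≤ r.den)]
      have : (r.den : ℝ) ≤ N := by exact_mod_cast hlt.le
      have : |(r : ℝ)| * r.den ≤ (|α| + 1) * N := by gcongr
      linarith
    have h5 : |r.num| ≤ (M : ℤ) := by exact_mod_cast h4
    exact ⟨abs_le.1 h5, hlt.le⟩
  · intro r _ s _ h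
    simp only [Prod.mk.injEq] at h
    exact Rat.ext h.1 h.2

lemma sum_mod_perm (q : ℕ) (hq : 0 < q) (p : ℤ) (hc : IsCoprime p (q : ℤ)) (G : ℕ → ℝ) :
    ∑ j ∈ range q, G (((j : ℤ) * p % q).toNat) = ∑ i ∈ range q, G i := by
  have hq' : (0 : ℤ) < q := by exact_mod_cast hq
  have hinj : Set.InjOn (fun j : ℕ => ((j : ℤ) * p % q).toNat) (range q) := by
    intro i hi j hj h
    simp only [coe_range, Set.mem_Iio] at hi hj
    have h1 := Int.emod_nonneg ((i : ℤ) * p) hq'.ne'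
    have h2 := Int.emod_nonneg ((j : ℤ) * p) hq'.ne'
    have h3 : (i : ℤ) * p % q = (j : ℤ) * p % q := by
      have : ((i : ℤ) * p % q).toNat = ((j : ℤ) * p % q).toNat := h
      omega
    have h4 : (q : ℤ) ∣ (j : ℤ) * p - i * p := Int.ModEq.dvd h3
    rw [← sub_mul] at h4
    have h5 : (q : ℤ) ∣ (j : ℤ) - i := hc.symm.dvd_of_dvd_mul_right h4
    have h6 : (j : ℤ) - i = 0 := by
      apply Int.eq_zero_of_abs_lt_dvd h5
      rw [abs_lt]; omega
    omega
  have himg : (range q).image (fun j : ℕ => ((j : ℤ) * p % q).toNat) = range q := by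
    apply Finset.eq_of_subset_of_card_le
    · intro i hi
      simp only [Finset.mem_image, Finset.mem_range] at hi ⊢
      obtain ⟨j, _, rfl⟩ := hi
      have h1 := Int.emod_nonneg ((j : ℤ) * p) hq'.ne'
      have h2 := Int.emod_lt_of_pos ((j : ℤ) * p) hq'
      omega
    · rw [Finset.card_image_of_injOn hinj]
  conv_rhs => rw [← himg]
  rw [Finset.sum_image hinj]

lemma dk_core (g P Q : ℝ → ℝ) (hg : Continuous g) (hper : ∀ (t : ℝ) (l : ℤ), g (t - l) = g t)
    (hint : ∀ b, ∫ t in b..b + 1, g t = 0)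
    (hP : MonotoneOn P (Set.Icc (-1) 2)) (hQ : MonotoneOn Q (Set.Icc (-1) 2)) (hPQ : g = P - Q)
    (x : ℝ) (hx0 : 0 ≤ x) (hx1 : x ≤ 1) (α : ℝ) (q : ℕ) (hq : 0 < q) (p : ℤ)
    (hc : IsCoprime p (q : ℤ)) (happ : |α - p / q| < 1 / (q : ℝ) ^ 2) :
    ∑ j ∈ range q, g (x + j * α) ≤ (P 2 - P (-1)) + (Q 2 - Q (-1)) := by
  have hqR : (0 : ℝ) < q := by exact_mod_cast hq
  have hq1 : (1 : ℝ) ≤ q := by exact_mod_cast hq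
  obtain ⟨θ, hθ0, hθ1, hθ⟩ : ∃ θ : ℝ, -1 ≤ θ ∧ θ ≤ 0 ∧ ∀ j < q,
      θ ≤ j * (α - p / q) ∧ j * (α - p / q) ≤ θ + 1 / q := by
    have hb : ∀ j < q, |(j : ℝ) * (α - p / q)| ≤ 1 / q := by
      intro j hj
      have hj' : (j : ℝ) ≤ q := by exact_mod_cast hj.le
      rw [abs_mul, abs_of_nonneg (by positivity : (0 : ℝ) ≤ j)]
      calc (j : ℝ) * |α - p / q| ≤ q * (1 / (q : ℝ) ^ 2) := by gcongr
        _ = 1 / q := by field_simp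
    have hq2 : 1 / (q : ℝ) ≤ 1 := by rw [div_le_one hqR]; exact hq1
    rcases le_total 0 (α - p / q) with h | h
    · refine ⟨0, by norm_num, le_rfl, fun j hj => ⟨by positivity, ?_⟩⟩
      have := (abs_le.1 (hb j hj)).2
      linarith
    · refine ⟨-(1 / q), by linarith, by simp, fun j hj => ⟨(abs_le.1 (hb j hj)).1, ?_⟩⟩
      have : (j : ℝ) * (α - p / q) ≤ 0 := mul_nonpos_of_nonneg_of_nonpos (by positivity) h
      linarith
  set b : ℝ := x + θ with hb
  set c : ℕ → ℝ := fun i => b + i / q with hcdef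
  have hc0 : c 0 = b := by simp [hcdef]
  have hcq : c q = b + 1 := by simp [hcdef, hqR.ne']
  have hstep : ∀ i, c (i + 1) = c i + 1 / q := by
    intro i; simp only [hcdef]; push_cast; ring
  have hcmem : ∀ i ≤ q, c i ∈ Set.Icc (-1 : ℝ) 2 := by
    intro i hi
    have h1 : (i : ℝ) / q ≤ 1 := by
      rw [div_le_one hqR]; exact_mod_cast hi
    have h2 : (0 : ℝ) ≤ (i : ℝ) / q := by positivity
    constructor <;> simp only [hcdef, hb] <;> linarith
  -- bound on a piece
  set I : ℕ → ℝ := fun i => q * (∫ t in c i..c (i + 1), g t) +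
    ((P (c (i + 1)) - P (c i)) + (Q (c (i + 1)) - Q (c i))) with hI
  have hpiece : ∀ i < q, ∀ y ∈ Set.Icc (c i) (c (i + 1)), g y ≤ I i := by
    intro i hi y hy
    set V := ((P (c (i + 1)) - P (c i)) + (Q (c (i + 1)) - Q (c i))) with hV
    have m1 := hcmem i hi.le
    have m2 := hcmem (i + 1) hi
    have hle : c i ≤ c (i + 1) := by rw [hstep]; have : 0 < 1 / (q : ℝ) := by positivity
                                     linarith
    have hmem : ∀ t ∈ Set.Icc (c i) (c (i + 1)), t ∈ Set.Icc (-1 : ℝ) 2 := fun t ht =>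
      ⟨m1.1.trans ht.1, ht.2.trans m2.2⟩
    have hosc : ∀ t ∈ Set.Icc (c i) (c (i + 1)), g y - V ≤ g t := by
      intro t ht
      have a1 := hP (hmem y hy) m2 hy.2
      have a2 := hP m1 (hmem t ht) ht.1
      have a3 := hQ m1 (hmem y hy) hy.1
      have a4 := hQ (hmem t ht) m2 ht.2
      simp only [hPQ, Pi.sub_apply, hV]
      linarith
    have hi2 : ∫ t in c i..c (i + 1), (g y - V) ≤ ∫ t in c i..c (i + 1), g t :=
      intervalIntegral.integral_mono_on hle (by simp) (hg.intervalIntegrable _ _) hosc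
    rw [intervalIntegral.integral_const, smul_eq_mul, hstep i, add_sub_cancel_left] at hi2
    have : q * (1 / q * (g y - V)) ≤ q * ∫ t in c i..c i + 1 / q, g t := by gcongr
    rw [← mul_assoc, mul_one_div_cancel hqR.ne', one_mul] at this
    simp only [hI]
    rw [← hV, hstep i]
    linarith
  have hsum : ∑ i ∈ range q, I i ≤ (P 2 - P (-1)) + (Q 2 - Q (-1)) := by
    simp only [hI]
    rw [Finset.sum_add_distrib, ← Finset.mul_sum,
      intervalIntegral.sum_integral_adjacent_intervals (fun k _ => hg.intervalIntegrable _ _),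
      hc0, hcq, hint, mul_zero, zero_add, Finset.sum_add_distrib,
      Finset.sum_range_sub (fun i => P (c i)), Finset.sum_range_sub (fun i => Q (c i))]
    have e0 := hcmem 0 (Nat.zero_le _)
    have e1 := hcmem q le_rfl
    have l : (-1 : ℝ) ∈ Set.Icc (-1 : ℝ) 2 := by constructor <;> norm_num
    have r : (2 : ℝ) ∈ Set.Icc (-1 : ℝ) 2 := by constructor <;> norm_num
    have a1 := hP l e0 e0.1
    have a2 := hP e1 r e1.2
    have a3 := hQ l e0 e0.1
    have a4 := hQ e1 r e1.2
    linarith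
  refine le_trans ?_ hsum
  rw [← sum_mod_perm q hq p hc I]
  refine Finset.sum_le_sum fun j hj => ?_
  have hj := Finset.mem_range.1 hj
  have hq' : (0 : ℤ) < q := by exact_mod_cast hq
  have h1 := Int.emod_nonneg ((j : ℤ) * p) hq'.ne'
  have h2 := Int.emod_lt_of_pos ((j : ℤ) * p) hq'
  have h3 := Int.emod_add_mul_ediv ((j : ℤ) * p) q
  set i := ((j : ℤ) * p % q).toNat with hidef
  set l := (j : ℤ) * p / q with hl
  have hi : i < q := by omega
  have h4 : (i : ℤ) + q * l = j * p := by omega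
  have h5 : (i : ℝ) + q * l = j * p := by exact_mod_cast h4
  rw [← hper _ l]
  apply hpiece i hi
  have h6 := hθ j hj
  have h7 : x + j * α - l = x + i / q + j * (α - p / q) := by
    have : (i : ℝ) / q = j * p / q - l := by
      rw [← h5]; field_simp; ring
    rw [this]; ring
  rw [hstep, h7]
  constructor <;> simp only [hcdef, hb] <;> linarith [h6.1, h6.2]

lemma dk (𝔣 : UnitAddCircle → ℝ) (h𝔣 : ZeroMeanBV 𝔣) (α : ℝ) (hα : Irrational α)
    (x : UnitAddCircle) :
    ∃ C : ℝ, ∀ N : ℕ, ∃ q ≥ N, ∑ i ∈ range q, 𝔣 (pt α x i) ≤ C := by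
  obtain ⟨hcont, hbv, hint⟩ := h𝔣
  set g : ℝ → ℝ := fun t => 𝔣 (t : UnitAddCircle) with hg
  have hgc : Continuous g := hcont.comp (AddCircle.continuous_mk' 1)
  have hper : ∀ (t : ℝ) (l : ℤ), g (t - l) = g t := by
    intro t l
    have : ((t - l : ℝ) : UnitAddCircle) = t := by
      rw [AddCircle.coe_sub]
      have : ((l : ℝ) : UnitAddCircle) = 0 := by
        have := AddCircle.coe_eq_zero_iff (p := (1:ℝ)) (x := (l : ℝ))
        exact this.2 ⟨l, by simp⟩
      rw [this, sub_zero]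
    simp only [hg, this]
  have hint' : ∀ b, ∫ t in b..b + 1, g t = 0 := fun b => by
    rw [← hint]; exact UnitAddCircle.intervalIntegral_preimage b 𝔣
  have hpieces : ∀ l : ℤ, eVariationOn g (Set.Icc (l : ℝ) (l + 1)) ≠ ⊤ := by
    intro l
    have h := eVariationOn.comp_eq_of_monotoneOn g (t := Set.Icc (l : ℝ) (l + 1))
      (fun t : ℝ => t - l) (fun s _ t _ h => by simpa using h)
    have e : g ∘ (fun t : ℝ => t - l) = g := funext fun t => hper t l
    rw [e] at h
    rw [h, Set.image_sub_const_Icc]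
    simp only [sub_self, add_sub_cancel_left]
    exact hbv
  have hbv' : BoundedVariationOn g (Set.Icc (-1) 2) := by
    have a1 := eVariationOn.Icc_add_Icc g (s := Set.univ) (a := -1) (b := 0) (c := 1)
      (by norm_num) (by norm_num) trivial
    have a2 := eVariationOn.Icc_add_Icc g (s := Set.univ) (a := -1) (b := 1) (c := 2)
      (by norm_num) (by norm_num) trivial
    simp only [Set.univ_inter] at a1 a2
    unfold BoundedVariationOn
    rw [← a2, ← a1]
    have b1 := hpieces (-1)
    have b2 := hpieces 0
    have b3 := hpieces 1
    norm_num at b1 b2 b3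
    simp [b1, b2, b3]
  obtain ⟨P, Q, hP, hQ, hPQ⟩ := hbv'.locallyBoundedVariationOn.exists_monotoneOn_sub_monotoneOn
  refine ⟨(P 2 - P (-1)) + (Q 2 - Q (-1)), fun N => ?_⟩
  obtain ⟨r, hr, hr2⟩ := den_unbounded hα N
  refine ⟨r.den, hr, ?_⟩
  obtain ⟨y, hy, hyx⟩ : ∃ y : ℝ, (0 ≤ y ∧ y ≤ 1) ∧ (y : UnitAddCircle) = x := by
    obtain ⟨t, rfl⟩ := QuotientAddGroup.mk_surjective x
    refine ⟨Int.fract t, ⟨Int.fract_nonneg t, (Int.fract_lt_one t).le⟩, ?_⟩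
    change ((Int.fract t : ℝ) : AddCircle (1:ℝ)) = (t : AddCircle (1:ℝ))
    rw [← Int.self_sub_floor, AddCircle.coe_sub, sub_eq_self]
    exact AddCircle.coe_eq_zero_iff (p := (1:ℝ)).2 ⟨⌊t⌋, by simp⟩
  have key := dk_core g P Q hgc hper hint' hP hQ hPQ y hy.1 hy.2 α r.den r.den_pos r.num
    (by
      rw [Int.isCoprime_iff_nat_coprime]; simpa using r.reduced)
    (by rw [← Rat.cast_def]; exact hr2)
  convert key using 2 with i hi
  simp only [hg, pt, ← hyx, AddCircle.coe_add]
  simp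

lemma pOf_pos (f : UnitAddCircle → ℝ) (z) : 0 < pOf f z := by unfold pOf; positivity

lemma pOf_compl (f : UnitAddCircle → ℝ) (z) :
    1 - pOf f z = Real.exp (- f z) * pOf f z := by
  unfold pOf
  have := Real.exp_pos (f z)
  rw [Real.exp_neg]; field_simp; ring

lemma pOf_lt_one (f : UnitAddCircle → ℝ) (z) : pOf f z < 1 := by
  have := pOf_compl f z
  have h : 0 < Real.exp (- f z) * pOf f z := mul_pos (Real.exp_pos _) (pOf_pos f z)
  linarith

lemma pOf_neg (f : UnitAddCircle → ℝ) : pOf (fun z => - f z) = fun z => 1 - pOf f z := by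
  funext z
  unfold pOf
  have := Real.exp_pos (f z)
  rw [Real.exp_neg]; field_simp; ring

lemma pOf_cont {f : UnitAddCircle → ℝ} (hf : Continuous f) : Continuous (pOf f) := by
  unfold pOf
  refine (Real.continuous_exp.comp hf).div (continuous_const.add (Real.continuous_exp.comp hf)) ?_
  intro z; positivity

lemma zm_neg {f : UnitAddCircle → ℝ} (h : ZeroMeanBV f) : ZeroMeanBV (fun z => - f z) := by
  obtain ⟨h1, h2, h3⟩ := h
  refine ⟨h1.neg, ?_, by rw [integral_neg, h3, neg_zero]⟩
  unfold BoundedVariationOn at *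
  convert h2 using 1
  simp [eVariationOn, edist_neg_neg]

lemma pt_add (α : ℝ) (x : UnitAddCircle) (i j : ℤ) :
    pt α x (i + j) = pt α (pt α x i) j := by
  simp [pt, add_mul, add_assoc]

/-- limits exist -/
lemma wv_lim {p : UnitAddCircle → ℝ} (h0 : ∀ z, 0 ≤ p z) (h1 : ∀ z, p z ≤ 1) (α : ℝ)
    (x : UnitAddCircle) : ∃ W : ℤ → ℝ, (∀ j, Tendsto (fun m => wv p α x m j) atTop (nhds (W j))) ∧
      (∀ j, 0 ≤ W j) ∧ (∀ j, W j ≤ 1) ∧ ∀ j, W j = p (pt α x j) * (if j + 1 ≠ 0 then W (j + 1) else 0) +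
      (1 - p (pt α x j)) * (if j - 1 ≠ 0 then W (j - 1) else 0) := by
  have hanti : ∀ j, Antitone (fun m => wv p α x m j) := fun j =>
    antitone_nat_of_succ_le fun m => wv_succ_le h0 h1 α x m j
  have hbdd : ∀ j, BddBelow (Set.range (fun m => wv p α x m j)) := fun j =>
    ⟨0, by rintro _ ⟨m, rfl⟩; exact wv_nonneg h0 h1 α x m j⟩
  have ht : ∀ j, Tendsto (fun m => wv p α x m j) atTop (nhds (⨅ m, wv p α x m j)) := fun j =>
    tendsto_atTop_ciInf (hanti j) (hbdd j)
  refine ⟨fun j => ⨅ m, wv p α x m j, ht, fun j => ?_, fun j => ?_, fun j => ?_⟩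
  · exact le_ciInf fun m => wv_nonneg h0 h1 α x m j
  · have := ciInf_le (hbdd j) 0
    simpa [wv] using this
  · refine tendsto_nhds_unique ((tendsto_add_atTop_iff_nat 1).2 (ht j)) ?_
    simp only [wv]
    refine (tendsto_const_nhds.mul ?_).add (tendsto_const_nhds.mul ?_)
    · split_ifs
      · exact ht _
      · exact tendsto_const_nhds
    · split_ifs
      · exact ht _
      · exact tendsto_const_nhds

lemma wv_one (α : ℝ) (hα : Irrational α) (f : UnitAddCircle → ℝ)
    (hf : ZeroMeanBV f) (x : UnitAddCircle) :
    Tendsto (fun m => wv (pOf f) α x m 1) atTop (nhds 0) := by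
  obtain ⟨W, hW, hW0, hW1, hWh⟩ := wv_lim (fun z => (pOf_pos f z).le) (fun z => (pOf_lt_one f z).le) α x
  obtain ⟨C, hC⟩ := dk f hf α hα (pt α x 1)
  have key := harm_zero (fun j : ℕ => if j = 0 then 0 else W j)
    (fun j => f (pt α (pt α x 1) j)) (fun j => pOf f (pt α (pt α x 1) j)) (by simp)
    (fun j => by split_ifs; exacts [le_rfl, hW0 _])
    (fun j => by split_ifs; exacts [zero_le_one, hW1 _])
    (fun j => pOf_pos f _) (fun j => pOf_compl f _)
    (fun j => by
      have h := hWh (1 + j)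
      rw [pt_add] at h
      have e1 : (1 + (j : ℤ) + 1) = ((j + 2 : ℕ) : ℤ) := by push_cast; ring
      have e2 : (1 + (j : ℤ) - 1) = j := by ring
      have e3 : (1 + (j : ℤ)) = ((j + 1 : ℕ) : ℤ) := by push_cast; ring
      rw [e1, e2, e3] at h
      have c1 : (((j + 2 : ℕ) : ℤ) ≠ 0) := by omega
      rw [if_pos c1] at h
      simp only [Nat.add_eq_zero_iff, one_ne_zero, and_false, if_false, OfNat.ofNat_ne_zero]
      rw [h]
      by_cases hj : j = 0 <;> simp [hj]) C hC
  have : W 1 = 0 := by simpa using key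
  rw [← this]; exact hW 1

lemma wv_zero (α : ℝ) (hα : Irrational α) (f : UnitAddCircle → ℝ)
    (hf : ZeroMeanBV f) (x : UnitAddCircle) :
    Tendsto (fun m => wv (pOf f) α x m 0) atTop (nhds 0) := by
  have h1 := wv_one α hα f hf x
  have h2 := wv_one (-α) hα.neg _ (zm_neg hf) x
  rw [pOf_neg] at h2
  simp only [wv_refl] at h2
  rw [← tendsto_add_atTop_iff_nat 1]
  simp only [wv]
  have := (h1.const_mul (pOf f (pt α x 0))).add (h2.const_mul (1 - pOf f (pt α x 0)))
  simpa using this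

lemma wv_unif (α : ℝ) (hα : Irrational α) (f : UnitAddCircle → ℝ)
    (hf : ZeroMeanBV f) (ε : ℝ) (hε : 0 < ε) : ∃ m, ∀ x, wv (pOf f) α x m 0 < ε := by
  have h := Antitone.tendstoUniformly_of_forall_tendsto (F := fun m x => wv (pOf f) α x m 0)
    (f := fun _ => 0) (fun m => wv_cont (pOf_cont hf.1) α m 0)
    (antitone_nat_of_succ_le fun m x => wv_succ_le (fun z => (pOf_pos f z).le)
      (fun z => (pOf_lt_one f z).le) α x m 0) continuous_const (wv_zero α hα f hf)
  rw [Metric.tendstoUniformly_iff] at h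
  obtain ⟨m, hm⟩ := (h ε hε).exists
  refine ⟨m, fun x => ?_⟩
  have := hm x
  rw [dist_comm, Real.dist_eq, sub_zero] at this
  exact (le_abs_self _).trans_lt this

lemma step_nonneg (f : UnitAddCircle → ℝ) (α : ℝ) (x : UnitAddCircle) (i j : ℤ) :
    0 ≤ stepProb (pOf f) α x i j := by
  unfold stepProb
  have := pOf_pos f (pt α x i)
  have := pOf_lt_one f (pt α x i)
  split_ifs <;> linarith

lemma avoid_le (f : UnitAddCircle → ℝ) (α : ℝ) (x : UnitAddCircle)
    {Ω : Type} [MeasurableSpace Ω] (ℙ : Measure Ω) (ξ : ℕ → Ω → ℤ)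
    (h : IsQPWalk (pOf f) α x 0 ℙ ξ) (m : ℕ) : ∀ (n : ℕ) (k : ℕ → ℤ),
    ℙ {ω | (∀ i ≤ n, ξ i ω = k i) ∧ ∀ i, n < i → i ≤ n + m → ξ i ω ≠ 0} ≤
      ENNReal.ofReal (((if k 0 = 0 then (1 : ℝ) else 0) *
        ∏ i ∈ Finset.range n, stepProb (pOf f) α x (k i) (k (i + 1))) * wv (pOf f) α x m (k n)) := by
  have hw := wv_nonneg (fun z => (pOf_pos f z).le) (fun z => (pOf_lt_one f z).le) α x
  induction m with
  | zero =>
    intro n k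
    simp only [wv, mul_one]
    rw [← h.2.2 n k]
    exact measure_mono fun ω hω => hω.1
  | succ m ih =>
    intro n k
    set A := ((if k 0 = 0 then (1 : ℝ) else 0) *
        ∏ i ∈ Finset.range n, stepProb (pOf f) α x (k i) (k (i + 1))) with hA
    have hA0 : 0 ≤ A := by
      refine mul_nonneg (by split_ifs <;> norm_num) (Finset.prod_nonneg fun i _ => step_nonneg _ _ _ _ _)
    set E : ℤ → Set Ω := fun j => if j = 0 then ∅ else
      {ω | (∀ i ≤ n + 1, ξ i ω = (if i ≤ n then k i else j)) ∧
        ∀ i, n + 1 < i → i ≤ n + 1 + m → ξ i ω ≠ 0} with hE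
    have hsub : {ω | (∀ i ≤ n, ξ i ω = k i) ∧ ∀ i, n < i → i ≤ n + (m + 1) → ξ i ω ≠ 0} ⊆
        ⋃ j, E j := by
      rintro ω ⟨h1, h2⟩
      rw [Set.mem_iUnion]
      refine ⟨ξ (n + 1) ω, ?_⟩
      have h3 := h2 (n + 1) (by omega) (by omega)
      simp only [hE, if_neg h3]
      refine ⟨fun i hi => ?_, fun i hi hi' => h2 i (by omega) (by omega)⟩
      split_ifs with hin
      · exact h1 i hin
      · have : i = n + 1 := by omega
        rw [this]
    have hEj : ∀ j, ℙ (E j) ≤ ENNReal.ofReal (A * (stepProb (pOf f) α x (k n) j *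
        (if j ≠ 0 then wv (pOf f) α x m j else 0))) := by
      intro j
      by_cases hj : j = 0
      · simp [hE, hj]
      · simp only [hE, if_neg hj]
        refine (ih (n + 1) (fun i => if i ≤ n then k i else j)).trans (le_of_eq ?_)
        congr 1
        rw [Finset.prod_range_succ]
        have : ∏ i ∈ Finset.range n, stepProb (pOf f) α x (if i ≤ n then k i else j)
            (if i + 1 ≤ n then k (i + 1) else j) =
            ∏ i ∈ Finset.range n, stepProb (pOf f) α x (k i) (k (i + 1)) := by
          refine Finset.prod_congr rfl fun i hi => ?_
          have := Finset.mem_range.1 hi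
          rw [if_pos (by omega), if_pos (by omega)]
        rw [this]
        simp only [Nat.zero_le, if_true, le_refl, Nat.not_succ_le_self, if_false, hj, ne_eq,
          not_false_eq_true, hA]
        ring
    refine (measure_mono hsub).trans ((measure_iUnion_le _).trans ((ENNReal.tsum_le_tsum hEj).trans ?_))
    rw [tsum_eq_sum (s := {k n + 1, k n - 1})]
    · rw [Finset.sum_pair (by omega), ← ENNReal.ofReal_add]
      · apply le_of_eq
        congr 1
        have e : ¬ (k n - 1 = k n + 1) := by omega
        simp only [wv, stepProb, if_true, e, if_false]
        ring
      · refine mul_nonneg hA0 (mul_nonneg (step_nonneg _ _ _ _ _) ?_)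
        split_ifs; exacts [hw _ _, le_rfl]
      · refine mul_nonneg hA0 (mul_nonneg (step_nonneg _ _ _ _ _) ?_)
        split_ifs; exacts [hw _ _, le_rfl]
    · intro j hj
      simp only [Finset.mem_insert, Finset.mem_singleton, not_or] at hj
      simp [stepProb, hj.1, hj.2]

lemma late_le (f : UnitAddCircle → ℝ) (α : ℝ) (x : UnitAddCircle)
    {Ω : Type} [MeasurableSpace Ω] (ℙ : Measure Ω) (ξ : ℕ → Ω → ℤ)
    (h : IsQPWalk (pOf f) α x 0 ℙ ξ) (a : ℤ) (k m : ℕ) :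
    ℙ (visitEventLate ξ a k m) ≤ ENNReal.ofReal (wv (pOf f) α x m 0) := by
  have hsub : visitEventLate ξ a k m ⊆ ⋃ j : ℤ,
      {ω | (∀ i ≤ 0, ξ i ω = (fun _ => j) i) ∧ ∀ i, 0 < i → i ≤ 0 + m → ξ i ω ≠ 0} := by
    rintro ω ⟨n, hn, h1, -, -⟩
    rw [Set.mem_iUnion]
    refine ⟨ξ 0 ω, fun i hi => ?_, fun i hi hi' => h1 i (Finset.mem_Icc.2 ⟨hi, by omega⟩)⟩
    rw [Nat.le_zero.1 hi]
  refine (measure_mono hsub).trans ((measure_iUnion_le _).trans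
    ((ENNReal.tsum_le_tsum fun j => avoid_le f α x ℙ ξ h m 0 (fun _ => j)).trans ?_))
  rw [tsum_eq_single 0]
  · simp
  · intro j hj
    simp [hj]

/-- the explicit path -/
def pth (a : ℕ) (s : ℤ) (i : ℕ) : ℤ :=
  if i ≤ a then s * i else if Even (i - a) then s * a else s * (a + 1)

lemma pth_step (a : ℕ) (s : ℤ) (i : ℕ) :
    pth a s (i + 1) = pth a s i + s ∨ pth a s (i + 1) = pth a s i - s := by
  unfold pth
  rcases lt_trichotomy i a with h | h | h
  · left
    rw [if_pos (by omega), if_pos (by omega)]; push_cast; ring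
  · subst h
    left
    rw [if_neg (by omega), if_pos le_rfl]
    simp; ring
  · rw [if_neg (show ¬ i + 1 ≤ a by omega), if_neg (show ¬ i ≤ a by omega)]
    have : i + 1 - a = (i - a) + 1 := by omega
    rw [this]
    by_cases he : Even (i - a)
    · left
      simp [he, Nat.even_add_one]; ring
    · right
      simp [he, Nat.even_add_one]; ring

lemma pth_ne (a : ℕ) (ha : 0 < a) (s : ℤ) (hs : s ≠ 0) (i : ℕ) (hi : 1 ≤ i) : pth a s i ≠ 0 := by
  unfold pth
  split_ifs
  · exact mul_ne_zero hs (by omega)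
  · exact mul_ne_zero hs (by omega)
  · exact mul_ne_zero hs (by omega)

lemma pth_end (a : ℕ) (s : ℤ) (k : ℕ) : pth a s (a + 2 * k) = s * a := by
  unfold pth
  split_ifs with h1 h2
  · have : k = 0 := by omega
    simp [this]
  · rfl
  · exact absurd (by simp) h2

lemma pth_card (a : ℕ) (ha : 0 < a) (s : ℤ) (hs : s ≠ 0) (k : ℕ) :
    ((Finset.Icc 1 (a + 2 * k)).filter fun i => pth a s i = s * a).card = k + 1 := by
  induction k with
  | zero =>
    rw [Finset.card_eq_one]
    refine ⟨a, ?_⟩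
    ext i
    simp only [Finset.mem_filter, Finset.mem_Icc, Finset.mem_singleton, mul_zero, add_zero]
    constructor
    · rintro ⟨⟨h1, h2⟩, h3⟩
      rw [pth, if_pos h2] at h3
      have := mul_left_cancel₀ hs h3
      omega
    · rintro rfl
      exact ⟨⟨ha, le_rfl⟩, by simp [pth]⟩
  | succ k ih =>
    have e1 : pth a s (a + 2 * k + 1) ≠ s * a := by
      unfold pth
      rw [if_neg (by omega), if_neg]
      · intro h
        have := mul_left_cancel₀ hs h
        omega
      · have : a + 2 * k + 1 - a = 2 * k + 1 := by omega
        rw [this]; simp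
    have e2 := pth_end a s (k + 1)
    have e3 : a + 2 * (k + 1) = a + 2 * k + 1 + 1 := by ring
    rw [e3] at e2 ⊢
    rw [← Finset.insert_Icc_right_eq_Icc_add_one (by omega), ← Finset.insert_Icc_right_eq_Icc_add_one (by omega), Finset.filter_insert,
      Finset.filter_insert, if_pos e2, if_neg e1, Finset.card_insert_of_notMem, ih]
    simp

lemma visit_ge (f : UnitAddCircle → ℝ) (α : ℝ) (x : UnitAddCircle)
    {Ω : Type} [MeasurableSpace Ω] (ℙ : Measure Ω) (ξ : ℕ → Ω → ℤ)
    (h : IsQPWalk (pOf f) α x 0 ℙ ξ) (δ : ℝ) (hδ : 0 < δ) (h1 : ∀ z, δ ≤ pOf f z)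
    (h2 : ∀ z, δ ≤ 1 - pOf f z) (a : ℕ) (ha : 0 < a) (s : ℤ) (hs : s = 1 ∨ s = -1) (k : ℕ) :
    ENNReal.ofReal (δ ^ (a + 2 * k)) ≤ ℙ (visitEvent ξ (s * a) (k + 1)) := by
  have hs0 : s ≠ 0 := by rcases hs with rfl | rfl <;> norm_num
  have hsub : {ω | ∀ i ≤ a + 2 * k, ξ i ω = pth a s i} ⊆ visitEvent ξ (s * a) (k + 1) := by
    intro ω hω
    refine ⟨a + 2 * k, fun i hi => ?_, ?_, ?_⟩
    · have := Finset.mem_Icc.1 hi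
      rw [hω i this.2]
      exact pth_ne a ha s hs0 i this.1
    · rw [← pth_card a ha s hs0 k]
      congr 1
      refine Finset.filter_congr fun i hi => ?_
      rw [hω i (Finset.mem_Icc.1 hi).2]
    · rw [hω _ le_rfl, pth_end]
  refine le_trans ?_ (measure_mono hsub)
  rw [h.2.2]
  apply ENNReal.ofReal_le_ofReal
  have h0 : pth a s 0 = 0 := by simp [pth]
  rw [if_pos h0, one_mul]
  calc δ ^ (a + 2 * k) = ∏ i ∈ Finset.range (a + 2 * k), δ := by simp
    _ ≤ _ := by
      refine Finset.prod_le_prod (fun _ _ => hδ.le) fun i _ => ?_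
      have hor : pth a s (i + 1) = pth a s i + 1 ∨ pth a s (i + 1) = pth a s i - 1 := by
        rcases hs with rfl | rfl <;> rcases pth_step a _ i with h | h <;> rw [h] <;> simp [sub_eq_add_neg]
      unfold stepProb
      rcases hor with h | h
      · rw [if_pos h]; exact h1 _
      · rw [if_neg (by omega), if_pos h]; exact h2 _

lemma unif_ell {f : UnitAddCircle → ℝ} (hf : Continuous f) :
    ∃ δ : ℝ, 0 < δ ∧ (∀ z, δ ≤ pOf f z) ∧ ∀ z, δ ≤ 1 - pOf f z := by
  have hc := pOf_cont hf
  obtain ⟨z1, -, hz1⟩ := isCompact_univ.exists_isMinOn (Set.univ_nonempty (α := UnitAddCircle)) hc.continuousOn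
  obtain ⟨z2, -, hz2⟩ := isCompact_univ.exists_isMaxOn (Set.univ_nonempty (α := UnitAddCircle)) hc.continuousOn
  refine ⟨min (pOf f z1) (1 - pOf f z2), lt_min (pOf_pos f z1) (sub_pos.2 (pOf_lt_one f z2)),
    fun z => (min_le_left _ _).trans (hz1 (Set.mem_univ z)), fun z => (min_le_right _ _).trans ?_⟩
  have : pOf f z ≤ pOf f z2 := hz2 (Set.mem_univ z)
  linarith

/-- Lemma 2.3: if `𝔣` is continuous of bounded variation with
`∫_𝕋 𝔣 = 0`, `a ≠ 0`, `τ_1 < τ_2 < ⋯` are the moments of consecutive visits to `a` and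
`A_k` is the event that `τ_k` occurs before the first return to `0`, then for every `k`
and `ε > 0` there exists `m` with `ℙ_x(τ_k > m | A_k) < ε` for every `x ∈ 𝕋`. -/
theorem statement7 (α : ℝ) (hα : Irrational α) (𝔣 : UnitAddCircle → ℝ)
    (h𝔣 : ZeroMeanBV 𝔣) (a : ℤ) (ha : a ≠ 0) (k : ℕ) (hk : 1 ≤ k)
    (ε : ℝ) (hε : 0 < ε) :
    ∃ m : ℕ, ∀ (x : UnitAddCircle) (Ω : Type) [MeasurableSpace Ω] (ℙ : Measure Ω)
      (ξ : ℕ → Ω → ℤ), IsQPWalk (pOf 𝔣) α x 0 ℙ ξ →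
      (ℙ (visitEventLate ξ a k m)).toReal / (ℙ (visitEvent ξ a k)).toReal < ε := by
  obtain ⟨δ, hδ, h1, h2⟩ := unif_ell h𝔣.1
  obtain ⟨k, rfl⟩ : ∃ k', k = k' + 1 := ⟨k - 1, by omega⟩
  set c := δ ^ (a.natAbs + 2 * k) with hc
  have hc0 : 0 < c := pow_pos hδ _
  obtain ⟨m, hm⟩ := wv_unif α hα 𝔣 h𝔣 (ε * c) (mul_pos hε hc0)
  refine ⟨m, fun x Ω _ ℙ ξ hw => ?_⟩
  have := hw.1
  have hlate := late_le 𝔣 α x ℙ ξ hw a (k + 1) m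
  have hvis := visit_ge 𝔣 α x ℙ ξ hw δ hδ h1 h2 a.natAbs (Int.natAbs_pos.2 ha) a.sign
    (by rcases lt_trichotomy a 0 with h | h | h
        · right; exact Int.sign_eq_neg_one_of_neg h
        · exact absurd h ha
        · left; exact Int.sign_eq_one_of_pos h) k
  rw [Int.sign_mul_natAbs] at hvis
  have hv : c ≤ (ℙ (visitEvent ξ a (k + 1))).toReal :=
    (ENNReal.ofReal_le_iff_le_toReal (measure_ne_top _ _)).1 hvis
  have hl : (ℙ (visitEventLate ξ a (k + 1) m)).toReal ≤ wv (pOf 𝔣) α x m 0 :=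
    ENNReal.toReal_le_of_le_ofReal (wv_nonneg (fun z => (pOf_pos 𝔣 z).le)
      (fun z => (pOf_lt_one 𝔣 z).le) α x m 0) hlate
  rw [div_lt_iff₀ (hc0.trans_le hv)]
  calc _ ≤ _ := hl
    _ < ε * c := hm x
    _ ≤ _ := by gcongr
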